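/- Let s > 3/2 and s−1 ≤ s' ≤ s+1. There exists a constant C > 0, depending only on s and s', such that for all Schwartz vector fields f, g : ℝ³ → ℝ³ one has ∥f × g∥_{H^{s−1}} ≤ C ∥∇f∥_{H^{s'}} ∥g∥_{H^{s−1}}, where × is the pointwise cross product on ℝ³. (In the paper this is applied with f = u and g = ∂_t B.) -/

import Mathlib

open MeasureTheory SchwartzMap Real
open scoped FourierTransform

noncomputable section

/-- `ℝ³` as a Euclidean space. -/
abbrev E3 : Type := EuclideanSpace ℝ (Fin 3)

/-- The (squared-integral based) Sobolev `H^σ` norm of a complex-valued function on `ℝ³`,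
defined via the Fourier transform. -/
noncomputable def HNorm (σ : ℝ) (f : E3 → ℂ) : ℝ :=
  (∫ ξ : E3, (1 + ‖ξ‖ ^ 2) ^ σ * ‖𝓕 f ξ‖ ^ 2) ^ ((1 : ℝ) / 2)

/-- The Sobolev `H^σ` norm of a real-valued function. -/
noncomputable def HNormR (σ : ℝ) (f : E3 → ℝ) : ℝ :=
  HNorm σ (fun x => (f x : ℂ))

/-- The `j`-th partial derivative of a real-valued function on `ℝ³`. -/
noncomputable def pdR (j : Fin 3) (f : E3 → ℝ) : E3 → ℝ :=
  fun x => fderiv ℝ f x (EuclideanSpace.single j 1)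

/-- The `j`-th partial derivative of a complex-valued function on `ℝ³`. -/
noncomputable def pdC (j : Fin 3) (f : E3 → ℂ) : E3 → ℂ :=
  fun x => fderiv ℝ f x (EuclideanSpace.single j 1)

/-- The Sobolev `H^σ` norm of a vector field `u : ℝ³ → ℝ³`:
`∥u∥_{H^σ}² = Σ_i ∥u_i∥_{H^σ}²`. -/
noncomputable def VNorm (σ : ℝ) (u : Fin 3 → E3 → ℝ) : ℝ :=
  (∑ i : Fin 3, (HNormR σ (u i)) ^ 2) ^ ((1 : ℝ) / 2)

/-- `∥∇u∥_{H^σ}² = Σ_{i,j} ∥∂_j u_i∥_{H^σ}²` for a vector field `u : ℝ³ → ℝ³`. -/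
noncomputable def GradVNorm (σ : ℝ) (u : Fin 3 → E3 → ℝ) : ℝ :=
  (∑ i : Fin 3, ∑ j : Fin 3, (HNormR σ (pdR j (u i))) ^ 2) ^ ((1 : ℝ) / 2)

/-- The advection term `(u·∇)v`, with components `Σ_j u_j ∂_j v_i`. -/
noncomputable def adv (u v : Fin 3 → E3 → ℝ) : Fin 3 → E3 → ℝ :=
  fun i x => ∑ j : Fin 3, u j x * pdR j (v i) x

/-- The pointwise cross product of two vector fields on `ℝ³`. -/
noncomputable def crossVF (u v : Fin 3 → E3 → ℝ) : Fin 3 → E3 → ℝ :=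
  fun i x =>
    ![u 1 x * v 2 x - u 2 x * v 1 x,
      u 2 x * v 0 x - u 0 x * v 2 x,
      u 0 x * v 1 x - u 1 x * v 0 x] i

/-- A Schwartz vector field, viewed as a plain vector field. -/
noncomputable def toVF (u : Fin 3 → SchwartzMap E3 ℝ) : Fin 3 → E3 → ℝ :=
  fun i => ⇑(u i)

open scoped ENNReal SchwartzMap LineDeriv

/-- Peetre-type bound splitting the weight at frequency `ζ + η` into the two frequency regimes. -/
theorem bracket_rpow_add_le {σ : ℝ} (hσ : 0 ≤ σ) (ζ η : E3) :
    (1 + ‖ζ + η‖ ^ 2) ^ (σ / 2) ≤ 3 ^ σ * ((1 + ‖η‖ ^ 2) ^ (σ / 2) +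
      ‖ζ‖ * (1 + ‖ζ‖ ^ 2) ^ (σ / 2) * (1 + ‖η‖ ^ 2) ^ (-(1 / 2) : ℝ)) := by
  have h9 : (3 : ℝ) ^ σ = 9 ^ (σ / 2) := by
    rw [show (9 : ℝ) = 3 ^ (2 : ℝ) by norm_num, ← Real.rpow_mul (by norm_num)]
    ring_nf
  have hadd : ‖ζ + η‖ ^ 2 ≤ 2 * ‖ζ‖ ^ 2 + 2 * ‖η‖ ^ 2 := by
    have := norm_add_le ζ η
    nlinarith [norm_nonneg (ζ + η), sq_nonneg (‖ζ‖ - ‖η‖)]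
  rw [h9]
  rcases le_or_gt (‖ζ‖ ^ 2) (1 + ‖η‖ ^ 2) with h | h
  · calc (1 + ‖ζ + η‖ ^ 2) ^ (σ / 2) ≤ (9 * (1 + ‖η‖ ^ 2)) ^ (σ / 2) := by
          gcongr; nlinarith [sq_nonneg ‖η‖]
      _ = 9 ^ (σ / 2) * (1 + ‖η‖ ^ 2) ^ (σ / 2) := Real.mul_rpow (by norm_num) (by positivity)
      _ ≤ _ := by gcongr; exact le_add_of_nonneg_right (by positivity)
  · have hone : 1 ≤ ‖ζ‖ * (1 + ‖η‖ ^ 2) ^ (-(1 / 2) : ℝ) := by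
      rw [Real.rpow_neg (by positivity), ← Real.sqrt_eq_rpow, ← div_eq_mul_inv,
        one_le_div (by positivity)]
      exact Real.sqrt_le_iff.2 ⟨norm_nonneg _, h.le⟩
    calc (1 + ‖ζ + η‖ ^ 2) ^ (σ / 2) ≤ (9 * (1 + ‖ζ‖ ^ 2)) ^ (σ / 2) := by
          gcongr; nlinarith [sq_nonneg ‖η‖]
      _ = 9 ^ (σ / 2) * (1 * (1 + ‖ζ‖ ^ 2) ^ (σ / 2)) := by
          rw [one_mul]; exact Real.mul_rpow (by norm_num) (by positivity)
      _ ≤ 9 ^ (σ / 2) * (‖ζ‖ * (1 + ‖η‖ ^ 2) ^ (-(1 / 2) : ℝ) * (1 + ‖ζ‖ ^ 2) ^ (σ / 2)) := by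
          gcongr
      _ ≤ _ := by
          gcongr
          rw [mul_right_comm]
          exact le_add_of_nonneg_left (by positivity)

theorem ennreal_rpow_half_sq (z : ℝ≥0∞) : (z ^ (1 / 2 : ℝ)) ^ 2 = z := by
  rw [← ENNReal.rpow_natCast, ← ENNReal.rpow_mul]; norm_num

/-- The Cauchy–Schwarz inequality, squared. -/
theorem lintegral_mul_sq_le {α : Type*} [MeasurableSpace α] {μ : Measure α} {f g : α → ℝ≥0∞}
    (hf : AEMeasurable f μ) (hg : AEMeasurable g μ) :
    (∫⁻ x, f x * g x ∂μ) ^ 2 ≤ (∫⁻ x, f x ^ 2 ∂μ) * ∫⁻ x, g x ^ 2 ∂μ := by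
  have h := ENNReal.lintegral_mul_le_Lp_mul_Lq μ Real.HolderConjugate.two_two hf hg
  exact (pow_le_pow_left' h 2).trans_eq (by simp only [mul_pow, ennreal_rpow_half_sq, ENNReal.rpow_two])

/-- Young's inequality `‖f ⋆ g‖₂ ≤ ‖f‖₁ ‖g‖₂`, squared. -/
theorem lintegral_conv_sq_le {f g : E3 → ℝ≥0∞} (hf : Measurable f) (hg : Measurable g) :
    ∫⁻ x, (∫⁻ y, f y * g (x - y)) ^ 2 ≤ (∫⁻ y, f y) ^ 2 * ∫⁻ x, g x ^ 2 := by
  have hpt (x : E3) : (∫⁻ y, f y * g (x - y)) ^ 2 ≤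
      (∫⁻ y, f y) * ∫⁻ y, f y * g (x - y) ^ 2 := by
    have := lintegral_mul_sq_le (μ := volume) (f := fun y => f y ^ (1 / 2 : ℝ))
      (g := fun y => f y ^ (1 / 2 : ℝ) * g (x - y)) (by fun_prop) (by fun_prop)
    simpa only [← mul_assoc, ← sq, mul_pow, ennreal_rpow_half_sq] using this
  calc _ ≤ ∫⁻ x, (∫⁻ y, f y) * ∫⁻ y, f y * g (x - y) ^ 2 := lintegral_mono hpt
    _ = (∫⁻ y, f y) * ∫⁻ y, ∫⁻ x, f y * g (x - y) ^ 2 := by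
      rw [lintegral_const_mul _ (by fun_prop), lintegral_lintegral_swap (by fun_prop)]
    _ = (∫⁻ y, f y) * ∫⁻ y, f y * ∫⁻ x, g x ^ 2 := by
      congr 2 with y
      rw [lintegral_const_mul _ (by fun_prop),
        lintegral_sub_right_eq_self (fun x => g x ^ 2) y]
    _ = _ := by rw [lintegral_mul_const _ hf, sq, mul_assoc]

theorem lintegral_conv_sq_le' {f g : E3 → ℝ≥0∞} (hf : Measurable f) (hg : Measurable g) :
    ∫⁻ x, (∫⁻ y, f y * g (x - y)) ^ 2 ≤ (∫⁻ x, f x ^ 2) * (∫⁻ y, g y) ^ 2 := by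
  have hflip (x : E3) : ∫⁻ y, f y * g (x - y) = ∫⁻ y, g y * f (x - y) := by
    rw [← lintegral_sub_left_eq_self (fun y => g y * f (x - y)) x]
    simp only [sub_sub_cancel, mul_comm]
  simp only [hflip]
  rw [mul_comm]
  exact lintegral_conv_sq_le hg hf

theorem lintegral_bracket_lt_top {σ : ℝ} (hσ : 1 / 2 < σ) :
    ∫⁻ ξ : E3, ENNReal.ofReal ((‖ξ‖ ^ 2)⁻¹ * (1 + ‖ξ‖ ^ 2) ^ (-σ)) < ∞ := by
  have h : Integrable (fun ξ : E3 => (‖ξ‖ ^ 2)⁻¹ * (1 + ‖ξ‖ ^ 2) ^ (-σ)) := by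
    rw [integrable_fun_norm_addHaar volume
      (f := fun r : ℝ => (r ^ 2)⁻¹ * (1 + r ^ 2) ^ (-σ))]
    have h1 : Integrable (fun r : ℝ => (1 + ‖r‖ ^ 2) ^ (-(2 * σ) / 2)) :=
      integrable_rpow_neg_one_add_norm_sq (by simp; linarith)
    refine h1.integrableOn.congr_fun (fun r hr => ?_) measurableSet_Ioi
    have : (r : ℝ) ≠ 0 := ne_of_gt hr
    simp only [finrank_euclideanSpace, Fintype.card_fin, smul_eq_mul, Real.norm_eq_abs, sq_abs]
    rw [show -(2 * σ) / 2 = -σ by ring]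
    field_simp
  exact h.lintegral_lt_top

/-- Squared Sobolev norm of a Schwartz function, as an extended nonnegative real. -/
def sobolevSq (σ : ℝ) (a : 𝓢(E3, ℂ)) : ℝ≥0∞ :=
  ∫⁻ ξ, ENNReal.ofReal ((1 + ‖ξ‖ ^ 2) ^ σ * ‖𝓕 a ξ‖ ^ 2)

/-- Squared Sobolev norm of the gradient, up to the factor `(2π)²`. -/
def sobolevGradSq (σ : ℝ) (a : 𝓢(E3, ℂ)) : ℝ≥0∞ :=
  ∫⁻ ξ, ENNReal.ofReal (‖ξ‖ ^ 2 * (1 + ‖ξ‖ ^ 2) ^ σ * ‖𝓕 a ξ‖ ^ 2)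

/-- The pointwise product of Schwartz functions. -/
def schwartzMul (a b : 𝓢(E3, ℂ)) : 𝓢(E3, ℂ) := pairing (ContinuousLinearMap.mul ℂ ℂ) a b

theorem fourier_fourier_apply (a : 𝓢(E3, ℂ)) (x : E3) : 𝓕 (𝓕 a) x = a (-x) := by
  have h : 𝓕⁻ (𝓕 a) (-x) = a (-x) := by simp
  rwa [fourierInv_coe, Real.fourierInv_eq_fourier_neg, neg_neg, ← fourier_coe] at h

theorem fourier_schwartzMul (a b : 𝓢(E3, ℂ)) (ξ : E3) :
    𝓕 (schwartzMul a b) ξ = ∫ ζ, 𝓕 a ζ * 𝓕 b (ξ - ζ) := by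
  have h : 𝓕 (schwartzMul a b) =
      SchwartzMap.convolution (ContinuousLinearMap.mul ℂ ℂ) (𝓕 a) (𝓕 b) := by
    have hF : 𝓕 (𝓕 (schwartzMul a b)) =
        𝓕 (SchwartzMap.convolution (ContinuousLinearMap.mul ℂ ℂ) (𝓕 a) (𝓕 b)) := by
      rw [fourier_convolution]
      ext x
      simp [fourier_fourier_apply, schwartzMul]
    have := congrArg (fun c => 𝓕⁻ c) hF
    simpa using this
  rw [h, convolution_apply]
  rfl

/-- `∥â∥_{L¹}` is controlled by `∥∇a∥_{H^σ}`. -/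
theorem lintegral_fourier_sq_le {σ : ℝ} (a : 𝓢(E3, ℂ)) :
    (∫⁻ ζ, ‖𝓕 a ζ‖ₑ) ^ 2 ≤
      (∫⁻ ξ : E3, ENNReal.ofReal ((‖ξ‖ ^ 2)⁻¹ * (1 + ‖ξ‖ ^ 2) ^ (-σ))) * sobolevGradSq σ a := by
  have hm : Measurable (fun ξ => ‖𝓕 a ξ‖) := (𝓕 a).continuous.norm.measurable
  have h := lintegral_mul_sq_le (μ := (volume : Measure E3))
    (f := fun ξ => ENNReal.ofReal (‖ξ‖⁻¹ * (1 + ‖ξ‖ ^ 2) ^ (-σ / 2)))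
    (g := fun ξ => ENNReal.ofReal (‖ξ‖ * (1 + ‖ξ‖ ^ 2) ^ (σ / 2) * ‖𝓕 a ξ‖))
    (by fun_prop) (by fun_prop)
  have hpos (ξ : E3) : 0 < 1 + ‖ξ‖ ^ 2 := by positivity
  have hr (ξ : E3) (t : ℝ) : ((1 + ‖ξ‖ ^ 2) ^ (t / 2)) ^ 2 = (1 + ‖ξ‖ ^ 2) ^ t := by
    rw [← Real.rpow_natCast, ← Real.rpow_mul (hpos ξ).le]; simp
  have hae : ∀ᵐ ξ : E3, ‖𝓕 a ξ‖ₑ = ENNReal.ofReal (‖ξ‖⁻¹ * (1 + ‖ξ‖ ^ 2) ^ (-σ / 2)) *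
      ENNReal.ofReal (‖ξ‖ * (1 + ‖ξ‖ ^ 2) ^ (σ / 2) * ‖𝓕 a ξ‖) := by
    filter_upwards [compl_mem_ae_iff.2 (measure_singleton (0 : E3))] with ξ hξ
    have hξ' : ‖ξ‖ ≠ 0 := by simpa using hξ
    rw [← ENNReal.ofReal_mul (by positivity), ← ofReal_norm, neg_div,
      Real.rpow_neg (hpos ξ).le]
    congr 1
    have := (Real.rpow_pos_of_pos (hpos ξ) (σ / 2)).ne'
    field_simp
  rw [lintegral_congr_ae hae]
  refine h.trans (le_of_eq ?_)
  unfold sobolevGradSq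
  congr 1 <;> refine lintegral_congr fun ξ => ?_
  · rw [← ENNReal.ofReal_pow (by positivity), mul_pow, hr, inv_pow]
  · rw [← ENNReal.ofReal_pow (by positivity), mul_pow, mul_pow, hr]

theorem lintegral_bracket_mul_fourier_sq_le {σ : ℝ} (b : 𝓢(E3, ℂ)) :
    (∫⁻ η, ENNReal.ofReal ((1 + ‖η‖ ^ 2) ^ (-(1 / 2) : ℝ) * ‖𝓕 b η‖)) ^ 2 ≤
      (∫⁻ ξ : E3, ENNReal.ofReal ((‖ξ‖ ^ 2)⁻¹ * (1 + ‖ξ‖ ^ 2) ^ (-σ))) * sobolevSq σ b := by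
  have hm : Measurable (fun ξ => ‖𝓕 b ξ‖) := (𝓕 b).continuous.norm.measurable
  have h := lintegral_mul_sq_le (μ := (volume : Measure E3))
    (f := fun ξ => ENNReal.ofReal (‖ξ‖⁻¹ * (1 + ‖ξ‖ ^ 2) ^ (-σ / 2)))
    (g := fun ξ => ENNReal.ofReal ((1 + ‖ξ‖ ^ 2) ^ (σ / 2) * ‖𝓕 b ξ‖))
    (by fun_prop) (by fun_prop)
  have hpos (ξ : E3) : 0 < 1 + ‖ξ‖ ^ 2 := by positivity
  have hr (ξ : E3) (t : ℝ) : ((1 + ‖ξ‖ ^ 2) ^ (t / 2)) ^ 2 = (1 + ‖ξ‖ ^ 2) ^ t := by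
    rw [← Real.rpow_natCast, ← Real.rpow_mul (hpos ξ).le]; simp
  have hae : ∀ᵐ ξ : E3, ENNReal.ofReal ((1 + ‖ξ‖ ^ 2) ^ (-(1 / 2) : ℝ) * ‖𝓕 b ξ‖) ≤
      ENNReal.ofReal (‖ξ‖⁻¹ * (1 + ‖ξ‖ ^ 2) ^ (-σ / 2)) *
      ENNReal.ofReal ((1 + ‖ξ‖ ^ 2) ^ (σ / 2) * ‖𝓕 b ξ‖) := by
    filter_upwards [compl_mem_ae_iff.2 (measure_singleton (0 : E3))] with ξ hξ
    have hξ' : 0 < ‖ξ‖ := by simpa using hξ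
    rw [← ENNReal.ofReal_mul (by positivity), neg_div, Real.rpow_neg (hpos ξ).le (σ / 2),
      Real.rpow_neg (hpos ξ).le (1 / 2), ← Real.sqrt_eq_rpow]
    have := (Real.rpow_pos_of_pos (hpos ξ) (σ / 2)).ne'
    gcongr ENNReal.ofReal ?_
    calc (√(1 + ‖ξ‖ ^ 2))⁻¹ * ‖𝓕 b ξ‖ ≤ ‖ξ‖⁻¹ * ‖𝓕 b ξ‖ := by
          gcongr
          exact Real.le_sqrt_of_sq_le (by linarith)
      _ = _ := by field_simp
  refine (pow_le_pow_left' (lintegral_mono_ae hae) 2).trans (h.trans (le_of_eq ?_))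
  unfold sobolevSq
  congr 1 <;> refine lintegral_congr fun ξ => ?_
  · rw [← ENNReal.ofReal_pow (by positivity), mul_pow, hr, inv_pow]
  · rw [← ENNReal.ofReal_pow (by positivity), mul_pow, hr]

theorem ofReal_bracket_mul_fourier_schwartzMul_le {σ : ℝ} (hσ : 0 ≤ σ) (a b : 𝓢(E3, ℂ)) (ξ : E3) :
    ENNReal.ofReal ((1 + ‖ξ‖ ^ 2) ^ (σ / 2) * ‖𝓕 (schwartzMul a b) ξ‖) ≤
      ENNReal.ofReal (3 ^ σ) *
        ((∫⁻ ζ, ‖𝓕 a ζ‖ₑ *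
            ENNReal.ofReal ((1 + ‖ξ - ζ‖ ^ 2) ^ (σ / 2) * ‖𝓕 b (ξ - ζ)‖)) +
          ∫⁻ ζ, ENNReal.ofReal (‖ζ‖ * (1 + ‖ζ‖ ^ 2) ^ (σ / 2) * ‖𝓕 a ζ‖) *
            ENNReal.ofReal ((1 + ‖ξ - ζ‖ ^ 2) ^ (-(1 / 2) : ℝ) * ‖𝓕 b (ξ - ζ)‖)) := by
  have hma : Measurable (fun ξ => ‖𝓕 a ξ‖) := (𝓕 a).continuous.norm.measurable
  have hma' : Measurable (fun ξ => ‖𝓕 a ξ‖ₑ) := (𝓕 a).continuous.enorm.measurable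
  have hmb : Measurable (fun ζ => ‖𝓕 b (ξ - ζ)‖) :=
    ((𝓕 b).continuous.comp (by fun_prop)).norm.measurable
  rw [← lintegral_add_left (by fun_prop), ← lintegral_const_mul _ (by fun_prop),
    ENNReal.ofReal_mul (by positivity), ofReal_norm, fourier_schwartzMul]
  calc _ ≤ ENNReal.ofReal ((1 + ‖ξ‖ ^ 2) ^ (σ / 2)) * ∫⁻ ζ, ‖𝓕 a ζ * 𝓕 b (ξ - ζ)‖ₑ := by
        gcongr; exact enorm_integral_le_lintegral_enorm _
    _ ≤ ∫⁻ ζ, ENNReal.ofReal ((1 + ‖ξ‖ ^ 2) ^ (σ / 2)) * ‖𝓕 a ζ * 𝓕 b (ξ - ζ)‖ₑ :=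
        lintegral_const_mul_le _ _
    _ ≤ _ := by
        refine lintegral_mono fun ζ => ?_
        have h := bracket_rpow_add_le hσ ζ (ξ - ζ)
        rw [add_sub_cancel] at h
        rw [← ofReal_norm (𝓕 a ζ * 𝓕 b (ξ - ζ)), ← ofReal_norm (𝓕 a ζ), norm_mul,
          ← ENNReal.ofReal_mul (by positivity), ← ENNReal.ofReal_mul (by positivity),
          ← ENNReal.ofReal_mul (by positivity), ← ENNReal.ofReal_add (by positivity) (by positivity),
          ← ENNReal.ofReal_mul (by positivity)]
        refine ENNReal.ofReal_le_ofReal ?_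
        calc _ ≤ _ := mul_le_mul_of_nonneg_right h (by positivity)
          _ = _ := by ring

theorem ennreal_add_sq_le (x y : ℝ≥0∞) : (x + y) ^ 2 ≤ 2 * (x ^ 2 + y ^ 2) := by
  have h := ENNReal.rpow_add_le_mul_rpow_add_rpow x y (p := 2) (by norm_num)
  norm_num at h
  exact h

theorem ofReal_bracket_rpow_half_mul_sq (σ : ℝ) (ξ : E3) (z : ℂ) :
    ENNReal.ofReal ((1 + ‖ξ‖ ^ 2) ^ (σ / 2) * ‖z‖) ^ 2 =
      ENNReal.ofReal ((1 + ‖ξ‖ ^ 2) ^ σ * ‖z‖ ^ 2) := by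
  rw [← ENNReal.ofReal_pow (by positivity), mul_pow, ← Real.rpow_natCast ((1 + ‖ξ‖ ^ 2) ^ (σ / 2)),
    ← Real.rpow_mul (by positivity)]
  simp

theorem sobolevSq_schwartzMul_le {σ : ℝ} (hσ : 0 ≤ σ) (a b : 𝓢(E3, ℂ)) :
    sobolevSq σ (schwartzMul a b) ≤
      ENNReal.ofReal (3 ^ σ) ^ 2 * 4 *
        (∫⁻ ξ : E3, ENNReal.ofReal ((‖ξ‖ ^ 2)⁻¹ * (1 + ‖ξ‖ ^ 2) ^ (-σ))) *
        (sobolevGradSq σ a * sobolevSq σ b) := by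
  set K := ∫⁻ ξ : E3, ENNReal.ofReal ((‖ξ‖ ^ 2)⁻¹ * (1 + ‖ξ‖ ^ 2) ^ (-σ))
  have hma : Measurable (fun ξ => ‖𝓕 a ξ‖) := (𝓕 a).continuous.norm.measurable
  have hma' : Measurable (fun ξ => ‖𝓕 a ξ‖ₑ) := (𝓕 a).continuous.enorm.measurable
  have hmb : Measurable (fun ξ => ‖𝓕 b ξ‖) := (𝓕 b).continuous.norm.measurable
  let u : E3 → ℝ≥0∞ := fun η => ENNReal.ofReal ((1 + ‖η‖ ^ 2) ^ (σ / 2) * ‖𝓕 b η‖)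
  let v : E3 → ℝ≥0∞ := fun ζ => ENNReal.ofReal (‖ζ‖ * (1 + ‖ζ‖ ^ 2) ^ (σ / 2) * ‖𝓕 a ζ‖)
  let w : E3 → ℝ≥0∞ := fun η => ENNReal.ofReal ((1 + ‖η‖ ^ 2) ^ (-(1 / 2) : ℝ) * ‖𝓕 b η‖)
  have hu : Measurable u := by fun_prop
  have hv : Measurable v := by fun_prop
  have hw : Measurable w := by fun_prop
  have hu2 : ∫⁻ η, u η ^ 2 = sobolevSq σ b :=
    lintegral_congr fun η => ofReal_bracket_rpow_half_mul_sq σ η _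
  have hv2 : ∫⁻ ζ, v ζ ^ 2 = sobolevGradSq σ a := by
    refine lintegral_congr fun ζ => ?_
    simp only [v]
    rw [mul_assoc, ENNReal.ofReal_mul (norm_nonneg _), mul_pow, ofReal_bracket_rpow_half_mul_sq,
      ← ENNReal.ofReal_pow (norm_nonneg _), ← ENNReal.ofReal_mul (by positivity), mul_assoc]
  have hconv {p q : E3 → ℝ≥0∞} (hp : Measurable p) (hq : Measurable q) :
      Measurable fun ξ => (∫⁻ ζ, p ζ * q (ξ - ζ)) ^ 2 := by fun_prop
  calc sobolevSq σ (schwartzMul a b)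
      = ∫⁻ ξ, ENNReal.ofReal ((1 + ‖ξ‖ ^ 2) ^ (σ / 2) * ‖𝓕 (schwartzMul a b) ξ‖) ^ 2 :=
        lintegral_congr fun ξ => (ofReal_bracket_rpow_half_mul_sq σ ξ _).symm
    _ ≤ ∫⁻ ξ, ENNReal.ofReal (3 ^ σ) ^ 2 * 2 * ((∫⁻ ζ, ‖𝓕 a ζ‖ₑ * u (ξ - ζ)) ^ 2 +
          (∫⁻ ζ, v ζ * w (ξ - ζ)) ^ 2) := by
        refine lintegral_mono fun ξ => ?_
        refine (pow_le_pow_left' (ofReal_bracket_mul_fourier_schwartzMul_le hσ a b ξ) 2).trans ?_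
        rw [mul_pow, mul_assoc]
        gcongr
        exact ennreal_add_sq_le _ _
    _ = ENNReal.ofReal (3 ^ σ) ^ 2 * 2 * ((∫⁻ ξ, (∫⁻ ζ, ‖𝓕 a ζ‖ₑ * u (ξ - ζ)) ^ 2) +
          ∫⁻ ξ, (∫⁻ ζ, v ζ * w (ξ - ζ)) ^ 2) := by
        rw [lintegral_const_mul' _ _ (by finiteness),
          lintegral_add_left (hconv hma' hu)]
    _ ≤ ENNReal.ofReal (3 ^ σ) ^ 2 * 2 * ((∫⁻ ζ, ‖𝓕 a ζ‖ₑ) ^ 2 * (∫⁻ η, u η ^ 2) +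
          (∫⁻ ζ, v ζ ^ 2) * (∫⁻ η, w η) ^ 2) := by
        gcongr
        · exact lintegral_conv_sq_le hma' hu
        · exact lintegral_conv_sq_le' hv hw
    _ ≤ ENNReal.ofReal (3 ^ σ) ^ 2 * 2 * (K * sobolevGradSq σ a * sobolevSq σ b +
          sobolevGradSq σ a * (K * sobolevSq σ b)) := by
        rw [hu2, hv2]
        gcongr
        · exact lintegral_fourier_sq_le a
        · exact lintegral_bracket_mul_fourier_sq_le b
    _ = _ := by ring

theorem sobolevSq_lt_top (σ : ℝ) (a : 𝓢(E3, ℂ)) : sobolevSq σ a < ∞ := by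
  have hg := Function.hasTemperateGrowth_one_add_norm_sq_rpow E3 (σ / 2)
  have h := (smulLeftCLM ℂ (fun x : E3 => (1 + ‖x‖ ^ 2) ^ (σ / 2)) (𝓕 a)).memLp 2
  have h2 := h.integrable_norm_pow (by norm_num)
  refine lt_of_eq_of_lt (lintegral_congr fun ξ => ?_) h2.lintegral_lt_top
  simp only [smulLeftCLM_apply_apply hg, norm_smul]
  rw [← ofReal_bracket_rpow_half_mul_sq, ← ENNReal.ofReal_pow (by positivity),
    Real.norm_of_nonneg (by positivity)]

theorem sobolevGradSq_le_sum (σ : ℝ) (a : 𝓢(E3, ℂ)) :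
    sobolevGradSq σ a ≤
      ∑ j : Fin 3, sobolevSq σ (∂_{EuclideanSpace.single j (1 : ℝ)} a) := by
  have hm : Measurable (fun ξ => ‖𝓕 a ξ‖) := (𝓕 a).continuous.norm.measurable
  unfold sobolevSq sobolevGradSq
  rw [← lintegral_finsetSum]
  swap
  · intro j _
    have := (𝓕 (∂_{EuclideanSpace.single j (1 : ℝ)} a)).continuous.norm.measurable
    fun_prop
  refine lintegral_mono fun ξ => ?_
  rw [← ENNReal.ofReal_sum_of_nonneg (fun _ _ => by positivity)]
  refine ENNReal.ofReal_le_ofReal ?_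
  have hF (j : Fin 3) : ‖𝓕 (∂_{EuclideanSpace.single j (1 : ℝ)} a) ξ‖ ^ 2 =
      (2 * π) ^ 2 * (ξ j ^ 2 * ‖𝓕 a ξ‖ ^ 2) := by
    have hg : (fun x : E3 => inner ℝ x (EuclideanSpace.single j (1 : ℝ))).HasTemperateGrowth := by
      fun_prop
    rw [fourier_lineDerivOp_eq, smul_apply, smulLeftCLM_apply_apply hg]
    simp [EuclideanSpace.inner_single_right, mul_pow,
      abs_of_pos Real.pi_pos]
  have hπ : 1 ≤ (2 * π) ^ 2 := by nlinarith [Real.pi_gt_three]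
  simp_rw [hF]
  rw [EuclideanSpace.norm_sq_eq ξ]
  calc _ = ∑ j, (1 + ‖ξ‖ ^ 2) ^ σ * (1 * (ξ j ^ 2 * ‖𝓕 a ξ‖ ^ 2)) := by
        rw [← EuclideanSpace.norm_sq_eq ξ, EuclideanSpace.norm_sq_eq ξ]
        simp only [Fin.sum_univ_three, Real.norm_eq_abs, sq_abs]
        ring
    _ ≤ _ := by rw [← EuclideanSpace.norm_sq_eq ξ]; gcongr

theorem sobolevSq_mono {σ τ : ℝ} (h : σ ≤ τ) (a : 𝓢(E3, ℂ)) : sobolevSq σ a ≤ sobolevSq τ a := by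
  refine lintegral_mono fun ξ => ENNReal.ofReal_le_ofReal ?_
  gcongr
  simp

theorem sobolevSq_sub_le (σ : ℝ) (a b : 𝓢(E3, ℂ)) :
    sobolevSq σ (a - b) ≤ 2 * (sobolevSq σ a + sobolevSq σ b) := by
  have hm : Measurable (fun ξ => ‖𝓕 a ξ‖) := (𝓕 a).continuous.norm.measurable
  unfold sobolevSq
  rw [← lintegral_add_left (by fun_prop), ← lintegral_const_mul' _ _ (by simp)]
  refine lintegral_mono fun ξ => ?_
  rw [← ENNReal.ofReal_add (by positivity) (by positivity), two_mul,
    ← ENNReal.ofReal_add (by positivity) (by positivity)]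
  refine ENNReal.ofReal_le_ofReal ?_
  have h : ‖𝓕 (a - b) ξ‖ ^ 2 ≤ 2 * (‖𝓕 a ξ‖ ^ 2 + ‖𝓕 b ξ‖ ^ 2) := by
    rw [show 𝓕 (a - b) = 𝓕 a - 𝓕 b from
      (FourierTransform.fourierCLM ℂ 𝓢(E3, ℂ)).map_sub a b, sub_apply]
    have := norm_sub_le (𝓕 a ξ) (𝓕 b ξ)
    nlinarith [norm_nonneg (𝓕 a ξ - 𝓕 b ξ), sq_nonneg (‖𝓕 a ξ‖ - ‖𝓕 b ξ‖)]
  calc _ ≤ _ := mul_le_mul_of_nonneg_left h (by positivity)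
    _ = _ := by ring

theorem sq_rpow_half {x : ℝ} (hx : 0 ≤ x) : (x ^ ((1 : ℝ) / 2)) ^ 2 = x := by
  rw [← Real.sqrt_eq_rpow, Real.sq_sqrt hx]

theorem HNorm_sq (σ : ℝ) (a : 𝓢(E3, ℂ)) : HNorm σ a ^ 2 = (sobolevSq σ a).toReal := by
  have hm : Measurable (fun ξ => ‖𝓕 a ξ‖) := (𝓕 a).continuous.norm.measurable
  unfold HNorm
  rw [sq_rpow_half (integral_nonneg fun ξ => by positivity), ← fourier_coe,
    integral_eq_lintegral_of_nonneg_ae (Filter.Eventually.of_forall fun ξ => by positivity)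
      (by fun_prop)]
  rfl

/-- A real-valued Schwartz function, viewed as a complex-valued one. -/
def complexify (f : 𝓢(E3, ℝ)) : 𝓢(E3, ℂ) := f.postcompCLM Complex.ofRealCLM

theorem HNormR_sq (σ : ℝ) (f : 𝓢(E3, ℝ)) :
    HNormR σ f ^ 2 = (sobolevSq σ (complexify f)).toReal := HNorm_sq σ (complexify f)

theorem HNormR_pdR_sq (σ : ℝ) (j : Fin 3) (f : 𝓢(E3, ℝ)) :
    HNormR σ (pdR j f) ^ 2 =
      (sobolevSq σ (∂_{EuclideanSpace.single j (1 : ℝ)} (complexify f))).toReal := by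
  rw [← HNorm_sq, HNormR]
  congr 2
  ext x
  have h := (Complex.ofRealCLM.hasFDerivAt (x := f x)).comp x (f.hasFDerivAt x)
  rw [lineDerivOp_apply_eq_fderiv, show ⇑(complexify f) = Complex.ofRealCLM ∘ f from rfl, h.fderiv]
  rfl

/-- The scalar product estimate `∥fg∥_{H^σ}² ≤ C ∥∇f∥_{H^τ}² ∥g∥_{H^σ}²`. -/
theorem exists_sobolevSq_schwartzMul_le {σ τ : ℝ} (hσ : 1 / 2 < σ) (h : σ ≤ τ) :
    ∃ C : ℝ, 0 < C ∧ ∀ a b : 𝓢(E3, ℂ), (sobolevSq σ (schwartzMul a b)).toReal ≤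
      C * (∑ j : Fin 3, (sobolevSq τ (∂_{EuclideanSpace.single j (1 : ℝ)} a)).toReal) *
        (sobolevSq σ b).toReal := by
  set K : ℝ≥0∞ := ENNReal.ofReal (3 ^ σ) ^ 2 * 4 *
    ∫⁻ ξ : E3, ENNReal.ofReal ((‖ξ‖ ^ 2)⁻¹ * (1 + ‖ξ‖ ^ 2) ^ (-σ)) with hK
  have hKtop : K ≠ ∞ := by
    rw [hK]
    exact ENNReal.mul_ne_top (by finiteness) (lintegral_bracket_lt_top hσ).ne
  refine ⟨K.toReal + 1, by positivity, fun a b => ?_⟩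
  have hsum : ∑ j : Fin 3, sobolevSq τ (∂_{EuclideanSpace.single j (1 : ℝ)} a) ≠ ∞ :=
    ENNReal.sum_ne_top.2 fun j _ => (sobolevSq_lt_top _ _).ne
  have hb := (sobolevSq_lt_top σ b).ne
  have hmain : sobolevSq σ (schwartzMul a b) ≤
      K * (∑ j : Fin 3, sobolevSq τ (∂_{EuclideanSpace.single j (1 : ℝ)} a)) * sobolevSq σ b := by
    rw [mul_assoc]
    refine (sobolevSq_schwartzMul_le (by linarith) a b).trans ?_
    gcongr
    exact (sobolevGradSq_le_sum σ a).trans (Finset.sum_le_sum fun j _ => sobolevSq_mono h _)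
  have hreal := ENNReal.toReal_mono (ENNReal.mul_ne_top (ENNReal.mul_ne_top hKtop hsum) hb) hmain
  rw [ENNReal.toReal_mul, ENNReal.toReal_mul,
    ENNReal.toReal_sum fun j _ => (sobolevSq_lt_top _ _).ne] at hreal
  refine hreal.trans ?_
  gcongr
  linarith

theorem HNormR_mul_sub_mul_sq_le (σ : ℝ) (f₁ f₂ g₁ g₂ : 𝓢(E3, ℝ)) :
    HNormR σ (fun x => f₁ x * g₁ x - f₂ x * g₂ x) ^ 2 ≤
      2 * ((sobolevSq σ (schwartzMul (complexify f₁) (complexify g₁))).toReal +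
        (sobolevSq σ (schwartzMul (complexify f₂) (complexify g₂))).toReal) := by
  have hcoe : (fun x => ((f₁ x * g₁ x - f₂ x * g₂ x : ℝ) : ℂ)) =
      ⇑(schwartzMul (complexify f₁) (complexify g₁) -
        schwartzMul (complexify f₂) (complexify g₂)) := by
    ext x
    simp [schwartzMul, complexify]
  rw [HNormR, hcoe, HNorm_sq,
    ← ENNReal.toReal_add (sobolevSq_lt_top _ _).ne (sobolevSq_lt_top _ _).ne,
    ← ENNReal.toReal_ofNat 2, ← ENNReal.toReal_mul]
  refine ENNReal.toReal_mono ?_ (sobolevSq_sub_le σ _ _)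
  have h₁ := (sobolevSq_lt_top σ (schwartzMul (complexify f₁) (complexify g₁))).ne
  have h₂ := (sobolevSq_lt_top σ (schwartzMul (complexify f₂) (complexify g₂))).ne
  finiteness

/-- Lemma 2.7: `∥f × g∥_{H^{s−1}} ≤ C ∥∇f∥_{H^{s'}} ∥g∥_{H^{s−1}}`
for `s > 3/2`, `s−1 ≤ s' ≤ s+1` and Schwartz vector fields `f, g`
(applied in the paper with `f = u`, `g = ∂_t B`). -/
theorem cross_estimate_u_dtB (s s' : ℝ) (hs : 3 / 2 < s)
    (hs'1 : s - 1 ≤ s') (hs'2 : s' ≤ s + 1) :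
    ∃ C : ℝ, 0 < C ∧ ∀ f g : Fin 3 → SchwartzMap E3 ℝ,
      VNorm (s - 1) (crossVF (toVF f) (toVF g)) ≤
        C * GradVNorm s' (toVF f) * VNorm (s - 1) (toVF g) := by
  obtain ⟨C, hC, hmul⟩ := exists_sobolevSq_schwartzMul_le (σ := s - 1) (τ := s') (by linarith) hs'1
  refine ⟨√(2 * C), by positivity, fun f g => ?_⟩
  let G : Fin 3 → ℝ := fun i => ∑ j, HNormR s' (pdR j (f i)) ^ 2
  let N : Fin 3 → ℝ := fun i => HNormR (s - 1) (g i) ^ 2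
  have hG (i : Fin 3) : 0 ≤ G i := Finset.sum_nonneg fun j _ => sq_nonneg _
  have hN (i : Fin 3) : 0 ≤ N i := sq_nonneg _
  have hprod (i j : Fin 3) : (sobolevSq (s - 1)
      (schwartzMul (complexify (f i)) (complexify (g j)))).toReal ≤ C * (G i * N j) := by
    have h := hmul (complexify (f i)) (complexify (g j))
    simp_rw [← HNormR_pdR_sq, ← HNormR_sq] at h
    rwa [← mul_assoc]
  have hcomp (i j : Fin 3) :
      HNormR (s - 1) (fun x => f i x * g j x - f j x * g i x) ^ 2 ≤
        2 * C * (G i * N j + G j * N i) := by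
    linarith [HNormR_mul_sub_mul_sq_le (s - 1) (f i) (f j) (g j) (g i), hprod i j, hprod j i]
  have hsum : ∑ i, HNormR (s - 1) (crossVF (toVF f) (toVF g) i) ^ 2 ≤
      2 * C * (∑ i, G i) * ∑ i, N i := by
    have h0 := hcomp 1 2
    have h1 := hcomp 2 0
    have h2 := hcomp 0 1
    have hdiag : 0 ≤ 2 * C * (G 0 * N 0 + G 1 * N 1 + G 2 * N 2) := by
      have := fun i => mul_nonneg (hG i) (hN i)
      have := add_nonneg (add_nonneg (this 0) (this 1)) (this 2)
      positivity
    rw [Fin.sum_univ_three, Fin.sum_univ_three, Fin.sum_univ_three]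
    refine (add_le_add (add_le_add h0 h1) h2).trans ?_
    linarith
  unfold VNorm GradVNorm
  simp only [← Real.sqrt_eq_rpow]
  rw [← Real.sqrt_mul (by positivity), ← Real.sqrt_mul (by positivity)]
  exact Real.sqrt_le_sqrt hsum

end
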